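/- Let f : ℝ^n → ℝ be differentiable at x with ∇f(x) ≠ 0. Let Q be a real n×d' matrix with Q Qᵀ ∇f(x) ≠ 0 satisfying ‖Qᵀ∇f(x)‖² ≥ (1−ε) d' ‖∇f(x)‖² for some ε ∈ (0,1) and ‖Q Qᵀ‖_op ≤ C n for some C > 0. Let P be a real n×m matrix one of whose columns equals Q Qᵀ∇f(x)/‖Q Qᵀ∇f(x)‖, let H be a symmetric m×m matrix with M₁ I_m ⪯ H for M₁ > 0, let c ∈ (0,1), α > 0, and d = −H Pᵀ∇f(x). If the Armijo condition f(x + αPd) ≤ f(x) + cα (Pᵀ∇f(x))ᵀ d holds, then f(x + αPd) − f(x) ≤ −c α M₁ ((1−ε) d' / (C n))² ‖∇f(x)‖². -/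

import Mathlib

open Matrix
open scoped RealInnerProductSpace

/-- The operator norm of a matrix acting between Euclidean spaces. -/
noncomputable def matOpNorm {n m : ℕ} (A : Matrix (Fin n) (Fin m) ℝ) : ℝ :=
  ‖LinearMap.toContinuousLinearMap (Matrix.toEuclideanLin A)‖

theorem inner_toEuclideanLin_transpose {n m : ℕ} (A : Matrix (Fin n) (Fin m) ℝ)
    (x : EuclideanSpace ℝ (Fin n)) (y : EuclideanSpace ℝ (Fin m)) :
    ⟪Matrix.toEuclideanLin Aᵀ x, y⟫ = ⟪x, Matrix.toEuclideanLin A y⟫ := by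
  rw [← Matrix.conjTranspose_eq_transpose_of_trivial,
    Matrix.toEuclideanLin_conjTranspose_eq_adjoint, LinearMap.adjoint_inner_left]

theorem norm_toEuclideanLin_le_matOpNorm {n m : ℕ} (A : Matrix (Fin n) (Fin m) ℝ)
    (x : EuclideanSpace ℝ (Fin m)) :
    ‖Matrix.toEuclideanLin A x‖ ≤ matOpNorm A * ‖x‖ :=
  (LinearMap.toContinuousLinearMap (Matrix.toEuclideanLin A)).le_opNorm x

theorem inner_toEuclideanLin_mul_transpose_self {n m : ℕ} (A : Matrix (Fin n) (Fin m) ℝ)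
    (x : EuclideanSpace ℝ (Fin n)) :
    ⟪x, Matrix.toEuclideanLin (A * Aᵀ) x⟫ = ‖Matrix.toEuclideanLin Aᵀ x‖ ^ 2 := by
  have h : Matrix.toEuclideanLin (A * Aᵀ) x =
      Matrix.toEuclideanLin A (Matrix.toEuclideanLin Aᵀ x) := by
    simp [Matrix.toLpLin_apply, Matrix.mulVec_mulVec]
  rw [h, ← inner_toEuclideanLin_transpose, real_inner_self_eq_norm_sq]

theorem Matrix.PosSemidef.mul_norm_sq_le_inner_toEuclideanLin {m : ℕ}
    {H : Matrix (Fin m) (Fin m) ℝ} {M : ℝ}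
    (hH : (H - M • (1 : Matrix (Fin m) (Fin m) ℝ)).PosSemidef)
    (y : EuclideanSpace ℝ (Fin m)) :
    M * ‖y‖ ^ 2 ≤ ⟪y, Matrix.toEuclideanLin H y⟫ := by
  have h := hH.dotProduct_mulVec_nonneg y.ofLp
  have hy : ‖y‖ ^ 2 = y.ofLp ⬝ᵥ y.ofLp := by
    rw [← real_inner_self_eq_norm_sq, EuclideanSpace.inner_eq_star_dotProduct, star_trivial]
  have hHy : ⟪y, Matrix.toEuclideanLin H y⟫ = y.ofLp ⬝ᵥ H *ᵥ y.ofLp := by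
    rw [EuclideanSpace.inner_eq_star_dotProduct, star_trivial, dotProduct_comm]
    rfl
  rw [star_trivial, Matrix.sub_mulVec, Matrix.smul_mulVec, Matrix.one_mulVec,
    dotProduct_sub, dotProduct_smul, smul_eq_mul] at h
  rw [hy, hHy]
  linarith

/-- Let `f` be differentiable with `∇f(x) ≠ 0`, `Q` with `QQᵀ∇f(x) ≠ 0`,
`‖Qᵀ∇f(x)‖² ≥ (1-ε) d' ‖∇f(x)‖²` and `‖QQᵀ‖_op ≤ C n`. Let `P` contain the column
`QQᵀ∇f(x)/‖QQᵀ∇f(x)‖`, `H` symmetric with `M₁ I ⪯ H`, `c ∈ (0,1)`, `α > 0`,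
`d = -H Pᵀ∇f(x)`. If the Armijo condition holds, then
`f(x+αPd) - f(x) ≤ -c α M₁ ((1-ε)d'/(Cn))² ‖∇f(x)‖²`. -/
theorem stmt5 {n m d' : ℕ} (f : EuclideanSpace ℝ (Fin n) → ℝ)
    (hf : Differentiable ℝ f)
    (x : EuclideanSpace ℝ (Fin n)) (hgrad : gradient f x ≠ 0)
    (Q : Matrix (Fin n) (Fin d') ℝ)
    (hQg : Matrix.toEuclideanLin (Q * Qᵀ) (gradient f x) ≠ 0)
    (ε : ℝ) (hε : ε ∈ Set.Ioo (0 : ℝ) 1)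
    (hlow : (1 - ε) * d' * ‖gradient f x‖ ^ 2 ≤
      ‖Matrix.toEuclideanLin Qᵀ (gradient f x)‖ ^ 2)
    (C : ℝ) (hC : 0 < C) (hop : matOpNorm (Q * Qᵀ) ≤ C * n)
    (P : Matrix (Fin n) (Fin m) ℝ)
    (hcol : ∃ j : Fin m,
      Matrix.toEuclideanLin P (EuclideanSpace.single j (1 : ℝ)) =
        ‖Matrix.toEuclideanLin (Q * Qᵀ) (gradient f x)‖⁻¹ •
          Matrix.toEuclideanLin (Q * Qᵀ) (gradient f x))
    (H : Matrix (Fin m) (Fin m) ℝ) (hH : H.IsHermitian)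
    (M₁ : ℝ) (hM₁ : 0 < M₁)
    (hHge : (H - M₁ • (1 : Matrix (Fin m) (Fin m) ℝ)).PosSemidef)
    (c : ℝ) (hc : c ∈ Set.Ioo (0 : ℝ) 1) (α : ℝ) (hα : 0 < α)
    (d : EuclideanSpace ℝ (Fin m))
    (hd : d = -(Matrix.toEuclideanLin H (Matrix.toEuclideanLin Pᵀ (gradient f x))))
    (hArmijo : f (x + α • Matrix.toEuclideanLin P d) ≤
      f x + c * α * ⟪Matrix.toEuclideanLin Pᵀ (gradient f x), d⟫) :
    f (x + α • Matrix.toEuclideanLin P d) - f x ≤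
      -(c * α * M₁) * ((1 - ε) * d' / (C * n)) ^ 2 * ‖gradient f x‖ ^ 2 := by
  obtain ⟨j, hj⟩ := hcol
  set g := gradient f x
  set v := Matrix.toEuclideanLin (Q * Qᵀ) g with hv
  set p := Matrix.toEuclideanLin Pᵀ g
  have hg : 0 < ‖g‖ := norm_pos_iff.mpr hgrad
  have hv_pos : 0 < ‖v‖ := norm_pos_iff.mpr hQg
  have hv_le : ‖v‖ ≤ C * n * ‖g‖ :=
    (norm_toEuclideanLin_le_matOpNorm _ _).trans (by gcongr)
  have hCn : 0 < C * n := pos_of_mul_pos_left (hv_pos.trans_le hv_le) hg.le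
  have hinner : ⟪p, EuclideanSpace.single j (1 : ℝ)⟫ =
      ‖v‖⁻¹ * ‖Matrix.toEuclideanLin Qᵀ g‖ ^ 2 := by
    rw [inner_toEuclideanLin_transpose, hj, real_inner_smul_right, hv,
      inner_toEuclideanLin_mul_transpose_self]
  have hp_inner : ‖v‖⁻¹ * ‖Matrix.toEuclideanLin Qᵀ g‖ ^ 2 ≤ ‖p‖ := by
    rw [← hinner]
    refine (real_inner_le_norm _ _).trans ?_
    simp
  have hε' : 0 ≤ 1 - ε := sub_nonneg.mpr hε.2.le
  have hp : (1 - ε) * d' / (C * n) * ‖g‖ ≤ ‖p‖ := by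
    refine le_trans ?_ hp_inner
    rw [inv_mul_eq_div, le_div_iff₀ hv_pos]
    calc (1 - ε) * d' / (C * n) * ‖g‖ * ‖v‖
        ≤ (1 - ε) * d' / (C * n) * ‖g‖ * (C * n * ‖g‖) := by gcongr
      _ = (1 - ε) * d' / (C * n) * (C * n) * ‖g‖ ^ 2 := by ring
      _ = (1 - ε) * d' * ‖g‖ ^ 2 := by rw [div_mul_cancel₀ _ hCn.ne']
      _ ≤ _ := hlow
  have hp_sq : ((1 - ε) * d' / (C * n)) ^ 2 * ‖g‖ ^ 2 ≤ ‖p‖ ^ 2 := by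
    rw [← mul_pow]
    gcongr
  have hdescent : M₁ * (((1 - ε) * d' / (C * n)) ^ 2 * ‖g‖ ^ 2) ≤
      ⟪p, Matrix.toEuclideanLin H p⟫ :=
    (mul_le_mul_of_nonneg_left hp_sq hM₁.le).trans
      (hHge.mul_norm_sq_le_inner_toEuclideanLin p)
  have hpd : ⟪p, d⟫ = -⟪p, Matrix.toEuclideanLin H p⟫ := by rw [hd, inner_neg_right]
  have hscaled := mul_le_mul_of_nonneg_left hdescent (mul_pos hc.1 hα).le
  rw [hpd] at hArmijo
  linarith
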